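/- For each θ > 0 with h = 1/θ an integer, every finite ordered tree t has a (10, θ)-bounded partition hierarchy of height h, i.e., a hierarchical partition in which the whole tree is the top zone, every zone at level ℓ ≥ 2 is partitioned into at most 10·n^θ zones of size at most n^{(ℓ-1)θ} (where n is the number of nodes of t), down to zones of size at most n^θ at level 1. -/

import Mathlib

/-- Finite ordered unranked trees over an alphabet `α`. -/
inductive OTree (α : Type) : Type
  | node : α → List (OTree α) → OTree α

namespace OTree

/-- The subtree of a tree at a path of child indices, if it exists. -/
def subtreeAux {α : Type} : List ℕ → OTree α → Option (OTree α)
  | [], t => some t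
  | i :: p, node _ ts => (ts[i]?).bind (subtreeAux p)

def subtree {α : Type} (t : OTree α) (p : List ℕ) : Option (OTree α) := subtreeAux p t

/-- `p` is (the path of) a node of `t`. -/
def IsNode {α : Type} (t : OTree α) (p : List ℕ) : Prop := (subtree t p).isSome

/-- The set of nodes (represented by their paths) of `t`. -/
def nodes {α : Type} (t : OTree α) : Set (List ℕ) := {p | IsNode t p}

/-- The number of children of the node `p` of `t`. -/
def numChildren {α : Type} (t : OTree α) (p : List ℕ) : ℕ :=
  match subtree t p with
  | some (node _ ts) => ts.length
  | none => 0

/-- A zone of `t`: a proper subforest (its top nodes form a consecutive interval of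
siblings), each node has all or none of its children in the zone, and there is at
most one vertical connection node (a node whose children are outside the zone). -/
def IsZone {α : Type} (t : OTree α) (S : Set (List ℕ)) : Prop :=
  (∀ p ∈ S, IsNode t p) ∧
  (∀ p ∈ S, (∀ i < numChildren t p, p ++ [i] ∈ S) ∨ (∀ i < numChildren t p, p ++ [i] ∉ S)) ∧
  {p | p ∈ S ∧ 0 < numChildren t p ∧ ∀ i < numChildren t p, p ++ [i] ∉ S}.Subsingleton ∧
  (∀ p ∈ S, ∀ q ∈ S, p ≠ [] → q ≠ [] → p.dropLast ∉ S → q.dropLast ∉ S →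
    p.dropLast = q.dropLast ∧
    ∀ i, p.getLastD 0 ≤ i → i ≤ q.getLastD 0 → p.dropLast ++ [i] ∈ S)

/-- A partition of the zone `S` into the zones collected in `Z`. -/
def IsZonePartition {α : Type} (t : OTree α) (S : Set (List ℕ))
    (Z : Finset (Set (List ℕ))) : Prop :=
  (∀ A ∈ Z, IsZone t A) ∧
  ((Z : Set (Set (List ℕ))).PairwiseDisjoint id) ∧
  ⋃₀ (Z : Set (Set (List ℕ))) = S

end OTree

namespace OTree

/-- `HasHierarchy t c θ n ℓ S`: the `ℓ`-zone `S` of `t` has a `(c,θ)`-bounded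
partition hierarchy of height `ℓ` (with respect to the size parameter `n`):
`S` is a zone with at most `n^{ℓθ}` nodes; for `ℓ ≥ 2` it is partitioned into at
most `c·n^θ` zones, each carrying a hierarchy of height `ℓ-1`. -/
def HasHierarchy {α : Type} (t : OTree α) (c : ℕ) (θ : ℝ) (n : ℕ) :
    ℕ → Set (List ℕ) → Prop
  | 0, _ => False
  | 1, S => IsZone t S ∧ (S.ncard : ℝ) ≤ (n : ℝ) ^ θ
  | (ℓ + 2), S =>
      IsZone t S ∧ (S.ncard : ℝ) ≤ (n : ℝ) ^ (((ℓ : ℝ) + 2) * θ) ∧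
      ∃ Z : Finset (Set (List ℕ)),
        (Z.card : ℝ) ≤ (c : ℝ) * (n : ℝ) ^ θ ∧
        ((Z : Set (Set (List ℕ))).PairwiseDisjoint id) ∧
        ⋃₀ (Z : Set (Set (List ℕ))) = S ∧
        ∀ A ∈ Z, HasHierarchy t c θ n (ℓ + 1) A

end OTree

namespace OTree

/-- A list of paths is a sibling interval if it consists of the root alone or enumerates
consecutive children of one node. -/
def IsSiblingInterval (L : List (List ℕ)) : Prop :=
  L = [[]] ∨ ∃ (p : List ℕ) (i k : ℕ), L = (List.range' i k).map fun c => p ++ [c]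

/-- The paths of the children of a node. -/
def children {α : Type} (t : OTree α) (p : List ℕ) : List (List ℕ) :=
  (List.range' 0 (numChildren t p)).map fun c => p ++ [c]

/-- The vertical connection nodes of a set of nodes. -/
def holes {α : Type} (t : OTree α) (S : Set (List ℕ)) : Set (List ℕ) :=
  {p | p ∈ S ∧ 0 < numChildren t p ∧ ∀ i < numChildren t p, p ++ [i] ∉ S}

/-- A zone in which every node is connected to one of the top nodes listed in `L`. -/
structure IsRootedZone {α : Type} (t : OTree α) (L : List (List ℕ)) (S : Set (List ℕ)) :
    Prop where
  interval : IsSiblingInterval L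
  top_mem : ∀ r ∈ L, r ∈ S
  conn : ∀ q ∈ S, ∃ r ∈ L, r <+: q ∧ ∀ p, r <+: p → p <+: q → p ∈ S
  isNode : ∀ q ∈ S, IsNode t q
  all_or_none : ∀ q ∈ S, (∀ i < numChildren t q, q ++ [i] ∈ S) ∨
    (∀ i < numChildren t q, q ++ [i] ∉ S)
  holes_subsingleton : (holes t S).Subsingleton

/-- `A` can be partitioned into at most `k` rooted zones of size at most `s`. -/
def HasPartition {α : Type} (t : OTree α) (s : ℝ) (A : Set (List ℕ)) (k : ℕ) : Prop :=
  ∃ Z : Finset (Set (List ℕ)), Z.card ≤ k ∧ (Z : Set (Set (List ℕ))).PairwiseDisjoint id ∧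
    ⋃₀ (Z : Set (Set (List ℕ))) = A ∧
    ∀ B ∈ Z, (∃ L, IsRootedZone t L B) ∧ (B.ncard : ℝ) ≤ s

/-- The nodes of `S` that are descendants of `p`. -/
def descendants (S : Set (List ℕ)) (p : List ℕ) : Set (List ℕ) := {q | q ∈ S ∧ p <+: q}

theorem subtree_append_singleton {α : Type} (t : OTree α) (p : List ℕ) (i : ℕ) :
    subtree t (p ++ [i]) = (subtree t p).bind fun u => subtree u [i] := by
  induction p generalizing t with
  | nil => rfl
  | cons a p ih =>
    obtain ⟨x, ts⟩ := t
    simp only [subtree, List.cons_append, subtreeAux] at ih ⊢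
    cases ts[a]? with
    | none => rfl
    | some u => exact ih u

theorem isNode_append_singleton {α : Type} (t : OTree α) (p : List ℕ) (i : ℕ) :
    IsNode t (p ++ [i]) ↔ i < numChildren t p := by
  unfold IsNode numChildren
  rw [subtree_append_singleton]
  cases subtree t p with
  | none => simp
  | some u =>
    obtain ⟨x, ts⟩ := u
    by_cases h : i < ts.length <;> simp [subtree, subtreeAux, h]

theorem IsNode.of_append_singleton {α : Type} {t : OTree α} {p : List ℕ} {i : ℕ}
    (h : IsNode t (p ++ [i])) : IsNode t p := by
  unfold IsNode at *
  rw [subtree_append_singleton] at h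
  cases hu : subtree t p with
  | none => simp [hu] at h
  | some u => rfl

theorem IsNode.of_prefix {α : Type} {t : OTree α} {p q : List ℕ}
    (h : IsNode t q) (hp : p <+: q) : IsNode t p := by
  obtain ⟨l, rfl⟩ := hp
  induction l using List.reverseRecOn with
  | nil => simpa using h
  | append_singleton l a ih =>
    rw [← List.append_assoc] at h
    exact ih h.of_append_singleton

theorem nodes_finite {α : Type} : ∀ t : OTree α, (nodes t).Finite
  | node a ts => by
    have hsub : nodes (node a ts) ⊆
        {[]} ∪ ⋃ i : Fin ts.length, (fun p => (i : ℕ) :: p) '' nodes ts[i] := by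
      rintro (_ | ⟨i, p⟩) hp
      · simp
      · right
        by_cases hi : i < ts.length
        · refine Set.mem_iUnion.2 ⟨⟨i, hi⟩, p, ?_, rfl⟩
          simpa [nodes, IsNode, subtree, subtreeAux, hi] using hp
        · simp [nodes, IsNode, subtree, subtreeAux, hi] at hp
    refine Set.Finite.subset (Set.Finite.union (Set.finite_singleton _)
      (Set.finite_iUnion fun i => Set.Finite.image _ ?_)) hsub
    exact nodes_finite ts[i]
termination_by t => sizeOf t
decreasing_by
  have := List.sizeOf_lt_of_mem (List.getElem_mem i.2 : ts[i] ∈ ts)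
  simp only [node.sizeOf_spec]
  simp only [Fin.getElem_fin] at *
  omega

theorem isSiblingInterval_singleton (p : List ℕ) : IsSiblingInterval [p] := by
  rcases List.eq_nil_or_concat p with rfl | ⟨q, c, rfl⟩
  · exact Or.inl rfl
  · exact Or.inr ⟨q, c, 1, by simp⟩

theorem isSiblingInterval_children {α : Type} (t : OTree α) (p : List ℕ) :
    IsSiblingInterval (children t p) := Or.inr ⟨p, 0, _, rfl⟩

theorem IsSiblingInterval.of_append {L M : List (List ℕ)} (h : IsSiblingInterval (L ++ M)) :
    IsSiblingInterval L ∧ IsSiblingInterval M := by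
  have hnil : IsSiblingInterval [] := Or.inr ⟨[], 0, 0, rfl⟩
  rcases h with h | ⟨p, i, k, h⟩
  · rcases List.append_eq_singleton_iff.1 h with ⟨rfl, rfl⟩ | ⟨rfl, rfl⟩
    · exact ⟨hnil, Or.inl rfl⟩
    · exact ⟨Or.inl rfl, hnil⟩
  · obtain ⟨a, b, hab, rfl, rfl⟩ := List.map_eq_append_iff.1 h.symm
    obtain ⟨m, hm, rfl, rfl⟩ := List.range'_eq_append_iff.1 hab
    exact ⟨Or.inr ⟨p, _, _, rfl⟩, Or.inr ⟨p, _, _, rfl⟩⟩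

theorem IsSiblingInterval.nodup {L : List (List ℕ)} (h : IsSiblingInterval L) : L.Nodup := by
  rcases h with rfl | ⟨p, i, k, rfl⟩
  · simp
  · exact List.Nodup.map (fun a b hab => by simpa using hab) List.nodup_range'

theorem IsSiblingInterval.eq_of_prefix {L : List (List ℕ)} (h : IsSiblingInterval L)
    {r r' q : List ℕ} (hr : r ∈ L) (hr' : r' ∈ L) (h1 : r <+: q) (h2 : r' <+: q) :
    r = r' := by
  have hlen : r.length = r'.length := by
    rcases h with rfl | ⟨p, i, k, rfl⟩
    · simp_all
    · obtain ⟨c, -, rfl⟩ := List.mem_map.1 hr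
      obtain ⟨d, -, rfl⟩ := List.mem_map.1 hr'
      simp
  exact (List.prefix_of_prefix_length_le h1 h2 hlen.le).eq_of_length hlen

theorem IsSiblingInterval.pairwise_disjoint_descendants {L : List (List ℕ)}
    (h : IsSiblingInterval L) (S : Set (List ℕ)) :
    L.Pairwise fun r r' => Disjoint (descendants S r) (descendants S r') := by
  refine h.nodup.imp_of_mem fun {r r'} hr hr' hne => ?_
  rw [Set.disjoint_left]
  exact fun q hq hq' => hne (h.eq_of_prefix hr hr' hq.2 hq'.2)

theorem IsRootedZone.isZone {α : Type} {t : OTree α} {L : List (List ℕ)} {S : Set (List ℕ)}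
    (h : IsRootedZone t L S) : IsZone t S := by
  refine ⟨h.isNode, h.all_or_none, h.holes_subsingleton, ?_⟩
  have top : ∀ p ∈ S, p ≠ [] → p.dropLast ∉ S → p ∈ L := by
    intro p hp hne hd
    obtain ⟨r, hr, hrp, hc⟩ := h.conn p hp
    rcases List.eq_nil_or_concat p with rfl | ⟨q, c, rfl⟩
    · exact absurd rfl hne
    · rw [List.concat_eq_append, List.prefix_concat_iff] at hrp
      rcases hrp with rfl | hrq
      · simpa using hr
      · exact absurd (hc q hrq (by simp)) (by simpa using hd)
  intro p hp q hq hp0 hq0 hpd hqd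
  have hpL := top p hp hp0 hpd
  have hqL := top q hq hq0 hqd
  have htop := h.top_mem
  rcases h.interval with rfl | ⟨u, i, k, rfl⟩
  · simp_all
  · obtain ⟨c, hc, rfl⟩ := List.mem_map.1 hpL
    obtain ⟨d, hd, rfl⟩ := List.mem_map.1 hqL
    simp only [List.mem_range'_1] at hc hd
    refine ⟨by simp, fun j hj hj' => ?_⟩
    simp only [List.getLastD_concat, List.dropLast_concat] at hj hj' ⊢
    exact htop _ (List.mem_map.2 ⟨j, by simp only [List.mem_range'_1]; omega, rfl⟩)

theorem isRootedZone_nodes {α : Type} (t : OTree α) : IsRootedZone t [[]] (nodes t) where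
  interval := Or.inl rfl
  top_mem := by simp [nodes, IsNode, subtree, subtreeAux]
  conn q hq := ⟨[], by simp, by simp, fun p _ hp => IsNode.of_prefix hq hp⟩
  isNode q hq := hq
  all_or_none q _ := Or.inl fun i hi => (isNode_append_singleton t q i).2 hi
  holes_subsingleton p hp :=
    absurd ((isNode_append_singleton t p 0).2 hp.2.1) (hp.2.2 0 hp.2.1)

theorem isRootedZone_singleton {α : Type} {t : OTree α} {p : List ℕ} (hp : IsNode t p) :
    IsRootedZone t [p] {p} where
  interval := isSiblingInterval_singleton p
  top_mem := by simp
  conn := by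
    rintro q rfl
    exact ⟨q, by simp, List.prefix_rfl, fun x h1 h2 => h2.eq_of_length_le h1.length_le⟩
  isNode := by rintro q rfl; exact hp
  all_or_none := by rintro q rfl; right; simp
  holes_subsingleton := Set.subsingleton_singleton.anti fun q hq => hq.1

theorem holes_iUnion_subset {α : Type} (t : OTree α) (L : List (List ℕ))
    (O : List ℕ → Set (List ℕ)) : holes t (⋃ r ∈ L, O r) ⊆ ⋃ r ∈ L, holes t (O r) := by
  rintro q ⟨hq, hc, hn⟩
  simp only [Set.mem_iUnion, exists_prop] at hq ⊢
  obtain ⟨r, hr, hq⟩ := hq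
  exact ⟨r, hr, hq, hc, fun i hi hm => hn i hi (Set.mem_biUnion hr hm)⟩

theorem IsRootedZone.iUnion {α : Type} {t : OTree α} {L : List (List ℕ)}
    {O : List ℕ → Set (List ℕ)} (hL : IsSiblingInterval L)
    (hO : ∀ r ∈ L, IsRootedZone t [r] (O r))
    (hh : (⋃ r ∈ L, holes t (O r)).Subsingleton) :
    IsRootedZone t L (⋃ r ∈ L, O r) where
  interval := hL
  top_mem r hr := Set.mem_biUnion hr ((hO r hr).top_mem r (by simp))
  conn q hq := by
    simp only [Set.mem_iUnion, exists_prop] at hq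
    obtain ⟨r, hr, hq⟩ := hq
    obtain ⟨r', hr', h1, h2⟩ := (hO r hr).conn q hq
    obtain rfl : r' = r := by simpa using hr'
    exact ⟨r', hr, h1, fun p hp hp' => Set.mem_biUnion hr (h2 p hp hp')⟩
  isNode q hq := by
    simp only [Set.mem_iUnion, exists_prop] at hq
    obtain ⟨r, hr, hq⟩ := hq
    exact (hO r hr).isNode q hq
  all_or_none q hq := by
    simp only [Set.mem_iUnion, exists_prop] at hq
    obtain ⟨r, hr, hq⟩ := hq
    refine ((hO r hr).all_or_none q hq).imp
      (fun h i hi => Set.mem_biUnion hr (h i hi)) (fun h i hi hmem => ?_)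
    simp only [Set.mem_iUnion, exists_prop] at hmem
    obtain ⟨r', hr', hq'⟩ := hmem
    obtain ⟨a, ha, hap, -⟩ := (hO r hr).conn q hq
    obtain ⟨b, hb, hbp, -⟩ := (hO r' hr').conn _ hq'
    simp only [List.mem_singleton] at ha hb
    subst ha hb
    obtain rfl := hL.eq_of_prefix hr hr' (hap.trans (List.prefix_append q [i])) hbp
    exact h i hi hq'
  holes_subsingleton := hh.anti (holes_iUnion_subset t L O)

theorem mem_children {α : Type} {t : OTree α} {p r : List ℕ} :
    r ∈ children t p ↔ ∃ i < numChildren t p, r = p ++ [i] := by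
  simp only [children, List.mem_map, List.mem_range'_1]
  constructor
  · rintro ⟨i, hi, rfl⟩; exact ⟨i, by omega, rfl⟩
  · rintro ⟨i, hi, rfl⟩; exact ⟨i, by omega, rfl⟩

theorem holes_insert_subset {α : Type} {t : OTree α} {p : List ℕ} {B : Set (List ℕ)}
    (hB : IsRootedZone t (children t p) B) : holes t (insert p B) ⊆ holes t B := by
  rintro q ⟨hq, hc, hn⟩
  rcases hq with rfl | hq
  · exact absurd (Set.mem_insert_of_mem _ (hB.top_mem _ (mem_children.2 ⟨0, hc, rfl⟩)))
      (hn 0 hc)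
  · exact ⟨hq, hc, fun i hi hm => hn i hi (Set.mem_insert_of_mem _ hm)⟩

theorem IsRootedZone.length_lt {α : Type} {t : OTree α} {p q : List ℕ} {B : Set (List ℕ)}
    (hB : IsRootedZone t (children t p) B) (hq : q ∈ B) : p.length < q.length := by
  obtain ⟨r, hr, hrq, -⟩ := hB.conn q hq
  obtain ⟨i, -, rfl⟩ := mem_children.1 hr
  have := hrq.length_le
  simp at this
  omega

theorem IsRootedZone.insert_top {α : Type} {t : OTree α} {p : List ℕ} {B : Set (List ℕ)}
    (hB : IsRootedZone t (children t p) B) (hp : IsNode t p) :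
    IsRootedZone t [p] (insert p B) where
  interval := isSiblingInterval_singleton p
  top_mem := by simp
  conn := by
    rintro q (rfl | hq)
    · exact ⟨q, by simp, List.prefix_rfl,
        fun x h1 h2 => Or.inl (h2.eq_of_length_le h1.length_le)⟩
    · obtain ⟨r, hr, hrq, hc⟩ := hB.conn q hq
      obtain ⟨i, hi, rfl⟩ := mem_children.1 hr
      refine ⟨p, by simp, (List.prefix_append p [i]).trans hrq, fun x h1 h2 => ?_⟩
      rcases h1.length_le.eq_or_lt with h | h
      · exact Or.inl (h1.eq_of_length h).symm
      · exact Or.inr (hc x (List.prefix_of_prefix_length_le hrq h2 (by simpa using h)) h2)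
  isNode := by
    rintro q (rfl | hq)
    · exact hp
    · exact hB.isNode q hq
  all_or_none := by
    rintro q (rfl | hq)
    · exact Or.inl fun i hi => Or.inr (hB.top_mem _ (mem_children.2 ⟨i, hi, rfl⟩))
    · refine (hB.all_or_none q hq).imp (fun h i hi => Or.inr (h i hi)) fun h i hi hm => ?_
      rcases hm with hm | hm
      · have := hB.length_lt hq
        rw [← hm] at this
        simp at this
      · exact h i hi hm
  holes_subsingleton := hB.holes_subsingleton.anti (holes_insert_subset hB)

theorem HasPartition.empty {α : Type} (t : OTree α) (s : ℝ) : HasPartition t s ∅ 0 :=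
  ⟨∅, by simp⟩

theorem IsRootedZone.hasPartition {α : Type} {t : OTree α} {s : ℝ} {L : List (List ℕ)}
    {A : Set (List ℕ)} (h : IsRootedZone t L A) (hs : (A.ncard : ℝ) ≤ s) :
    HasPartition t s A 1 :=
  ⟨{A}, by simp, by simp, by simp, by simpa using ⟨⟨L, h⟩, hs⟩⟩

open Classical in
theorem HasPartition.union {α : Type} {t : OTree α} {s : ℝ} {A B : Set (List ℕ)} {k l : ℕ}
    (hA : HasPartition t s A k) (hB : HasPartition t s B l) (hAB : Disjoint A B) :
    HasPartition t s (A ∪ B) (k + l) := by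
  obtain ⟨Y, hY, hYd, rfl, hYg⟩ := hA
  obtain ⟨Z, hZ, hZd, rfl, hZg⟩ := hB
  refine ⟨Y ∪ Z, (Finset.card_union_le _ _).trans (by omega), ?_, ?_, ?_⟩
  · rw [Finset.coe_union]
    exact hYd.union hZd fun i hi j hj _ =>
      hAB.mono (Set.subset_sUnion_of_mem hi) (Set.subset_sUnion_of_mem hj)
  · rw [Finset.coe_union, Set.sUnion_union]
  · intro B hB
    rcases Finset.mem_union.1 hB with h | h
    · exact hYg B h
    · exact hZg B h

theorem iUnion_mem_cons {ι β : Type} (A : ι → Set β) (r : ι) (L : List ι) :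
    ⋃ x ∈ r :: L, A x = A r ∪ ⋃ x ∈ L, A x := by
  ext; simp

theorem iUnion_mem_append {ι β : Type} (A : ι → Set β) (L M : List ι) :
    ⋃ x ∈ L ++ M, A x = (⋃ x ∈ L, A x) ∪ ⋃ x ∈ M, A x := by
  ext; simp [or_and_right, exists_or]

theorem HasPartition.iUnion {α ι : Type} {t : OTree α} {s : ℝ} {L : List ι}
    {A : ι → Set (List ℕ)} {k : ι → ℕ} (hA : ∀ r ∈ L, HasPartition t s (A r) (k r))
    (hd : L.Pairwise fun r r' => Disjoint (A r) (A r')) :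
    HasPartition t s (⋃ r ∈ L, A r) (L.map k).sum := by
  induction L with
  | nil => simpa using HasPartition.empty t s
  | cons r L ih =>
    rw [iUnion_mem_cons, List.map_cons, List.sum_cons]
    rw [List.pairwise_cons] at hd
    refine (hA r (by simp)).union (ih (fun x hx => hA x (by simp [hx])) hd.2) ?_
    simpa using hd.1

theorem hasPartition_ncard {α : Type} {t : OTree α} {s : ℝ} (hs : 1 ≤ s)
    {A : Set (List ℕ)} (hA : A.Finite) (hn : ∀ q ∈ A, IsNode t q) :
    HasPartition t s A A.ncard := by
  induction A, hA using Set.Finite.induction_on with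
  | empty => simpa using HasPartition.empty t s
  | @insert a A ha hf ih =>
    rw [Set.ncard_insert_of_notMem ha hf, add_comm, Set.insert_eq]
    exact ((isRootedZone_singleton (hn a (by simp))).hasPartition (by simpa using hs)).union
      (ih fun q hq => hn q (by simp [hq])) (by simpa using ha)

theorem ncard_iUnion_mem {ι β : Type} {L : List ι} {A : ι → Set β}
    (hf : ∀ r ∈ L, (A r).Finite) (hd : L.Pairwise fun r r' => Disjoint (A r) (A r')) :
    (⋃ r ∈ L, A r).ncard = (L.map fun r => (A r).ncard).sum := by
  induction L with
  | nil => simp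
  | cons r L ih =>
    rw [List.pairwise_cons] at hd
    have hfin : (⋃ x ∈ L, A x).Finite :=
      Set.Finite.biUnion (List.finite_toSet L) fun x hx => hf x (List.mem_cons_of_mem _ hx)
    rw [iUnion_mem_cons, List.map_cons, List.sum_cons,
      Set.ncard_union_eq (by simpa using hd.1) (hf r (by simp)) hfin,
      ih (fun x hx => hf x (by simp [hx])) hd.2]

/-- Greedy splitting of a weighted list, in which some entries are marked, into consecutive
chunks of weight at most `s` with at most one mark each. -/
theorem exists_chunks {ι : Type} {s : ℝ} (hs : 2 ≤ s) (w h : ι → ℕ) (L : List ι)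
    (hL : ∀ u ∈ L, (w u : ℝ) ≤ s ∧ h u ≤ 1 ∧ h u ≤ w u) :
    ∃ Ls : List (List ι), Ls.flatten = L ∧
      (∀ c ∈ Ls, ((c.map w).sum : ℝ) ≤ s ∧ (c.map h).sum ≤ 1) ∧
      (Ls.length : ℝ) * s ≤
        s + 2 * ((L.map w).sum - (L.map h).sum : ℝ) + s * (L.map h).sum := by
  have key : ∃ (c : List ι) (Ls : List (List ι)), (c :: Ls).flatten = L ∧
      (∀ d ∈ c :: Ls, ((d.map w).sum : ℝ) ≤ s ∧ (d.map h).sum ≤ 1 ∧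
        (d.map h).sum ≤ (d.map w).sum) ∧
      ((Ls.length : ℝ) + 1) * s + ((c.map w).sum - (c.map h).sum + s / 2 * (c.map h).sum) ≤
        s + 2 * ((L.map w).sum - (L.map h).sum : ℝ) + s * (L.map h).sum := by
    induction L with
    | nil => exact ⟨[], [], by simp, by simp; linarith, by simp⟩
    | cons u L ih =>
      obtain ⟨c, Ls, hfl, hc, hlen⟩ := ih fun x hx => hL x (by simp [hx])
      obtain ⟨hw, hh, hhw⟩ := hL u (by simp)
      have hu0 : (0 : ℝ) ≤ w u := Nat.cast_nonneg _
      have hh0 : (0 : ℝ) ≤ (s / 2 - 1) * h u :=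
        mul_nonneg (by linarith) (Nat.cast_nonneg _)
      by_cases hm : ((w u + (c.map w).sum : ℕ) : ℝ) ≤ s ∧ h u + (c.map h).sum ≤ 1
      · refine ⟨u :: c, Ls, by simp [← hfl], ?_, ?_⟩
        · rw [List.forall_mem_cons] at hc ⊢
          refine ⟨?_, hc.2⟩
          simp only [List.map_cons, List.sum_cons]
          exact ⟨hm.1, hm.2, by omega⟩
        · simp only [List.map_cons, List.sum_cons, Nat.cast_add]
          linarith
      · refine ⟨[u], c :: Ls, by simp [← hfl], ?_, ?_⟩
        · rw [List.forall_mem_cons]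
          exact ⟨by simpa using ⟨hw, hh, hhw⟩, hc⟩
        · obtain ⟨-, hc1, hcw⟩ := hc c (by simp)
          have hc0 : (0 : ℝ) ≤ ((c.map w).sum : ℕ) := Nat.cast_nonneg _
          have hpair : s ≤ (w u - h u + s / 2 * h u : ℝ) +
              ((c.map w).sum - (c.map h).sum + s / 2 * (c.map h).sum) := by
            generalize (c.map w).sum = x at *
            generalize (c.map h).sum = y at *
            push_cast at hm
            by_cases hy : h u + y ≤ 1
            · have hx : s < w u + x := by
                by_contra hcon
                exact hm ⟨by linarith, hy⟩
              have hy' : (h u + y : ℝ) = 0 ∨ (h u + y : ℝ) = 1 := by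
                have : h u + y = 0 ∨ h u + y = 1 := by omega
                exact_mod_cast this
              rcases hy' with hy' | hy'
              · have : (h u : ℝ) = - y := by linarith
                rw [this]; nlinarith
              · have : (h u : ℝ) = 1 - y := by linarith
                rw [this]; nlinarith
            · obtain ⟨h1, h2⟩ : h u = 1 ∧ y = 1 := by omega
              have h3 : (1 : ℝ) ≤ w u := by exact_mod_cast h1 ▸ hhw
              have h4 : (1 : ℝ) ≤ x := by exact_mod_cast h2 ▸ hcw
              rw [h1, h2]
              push_cast
              linarith
          simp only [List.map_cons, List.sum_cons, List.length_cons, List.map_nil,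
            List.sum_nil, add_zero, Nat.cast_add, Nat.cast_one]
          linarith
  obtain ⟨c, Ls, hfl, hc, hlen⟩ := key
  refine ⟨c :: Ls, hfl, fun d hd => ⟨(hc d hd).1, (hc d hd).2.1⟩, ?_⟩
  have hc0 : (0 : ℝ) ≤ ((c.map w).sum : ℕ) := Nat.cast_nonneg _
  have hh0 : (0 : ℝ) ≤ (s / 2 - 1) * ((c.map h).sum : ℕ) :=
    mul_nonneg (by linarith) (Nat.cast_nonneg _)
  rw [List.length_cons, Nat.cast_add, Nat.cast_one]
  linarith

theorem weighted_sum_le {ι : Type} {s : ℝ} (L : List ι) (k h c e : ι → ℕ)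
    (H : ∀ r ∈ L, (k r : ℝ) * s + 3 * s * h r ≤ 6 * (c r + h r) + 3 * s * e r) :
    ((L.map k).sum : ℝ) * s + 3 * s * (L.map h).sum ≤
      6 * ((L.map c).sum + (L.map h).sum) + 3 * s * (L.map e).sum := by
  induction L with
  | nil => simp
  | cons r L ih =>
    have h1 := H r (by simp)
    have h2 := ih fun x hx => H x (by simp [hx])
    simp only [List.map_cons, List.sum_cons, Nat.cast_add]
    linarith

theorem le_sum_map_of_mem {ι : Type} {L : List ι} (h : ι → ℕ) {r : ι} (hr : r ∈ L) :
    h r ≤ (L.map h).sum :=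
  List.single_le_sum (by simp) _ (List.mem_map_of_mem hr)

theorem add_le_sum_map_of_mem {ι : Type} {L : List ι} (h : ι → ℕ) {r r' : ι}
    (hr : r ∈ L) (hr' : r' ∈ L) (hne : r ≠ r') : h r + h r' ≤ (L.map h).sum := by
  induction L with
  | nil => simp at hr
  | cons a L ih =>
    rw [List.map_cons, List.sum_cons]
    rcases List.mem_cons.1 hr with rfl | hr
    · have := le_sum_map_of_mem h ((List.mem_cons.1 hr').resolve_left hne.symm)
      omega
    · rcases List.mem_cons.1 hr' with rfl | hr'
      · have := le_sum_map_of_mem (L := L) h (by assumption : r ∈ L)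
        omega
      · have := ih hr hr'
        omega

/-- The part of `S` below `p` splits into a rooted zone `O` containing `p`, with `h` connection
nodes, and a remainder `C` that is partitioned into `k` zones. -/
def HasOpenZone {α : Type} (t : OTree α) (s : ℝ) (S : Set (List ℕ)) (p : List ℕ) : Prop :=
  ∃ (O C : Set (List ℕ)) (k h : ℕ), IsRootedZone t [p] O ∧ (O.ncard : ℝ) ≤ s ∧
    O ∪ C = descendants S p ∧ Disjoint O C ∧ HasPartition t s C k ∧ h ≤ 1 ∧
    (h = 0 → holes t O = ∅) ∧
    (k : ℝ) * s + 3 * s * h ≤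
      6 * (C.ncard + h) + 3 * s * (holes t S ∩ descendants S p).ncard

theorem hasPartition_of_chunks {α : Type} {t : OTree α} {s : ℝ}
    {O : List ℕ → Set (List ℕ)} (Ls : List (List (List ℕ)))
    (hL : IsSiblingInterval Ls.flatten)
    (hd : Ls.flatten.Pairwise fun r r' => Disjoint (O r) (O r'))
    (hp : ∀ c ∈ Ls, IsSiblingInterval c → HasPartition t s (⋃ r ∈ c, O r) 1) :
    HasPartition t s (⋃ r ∈ Ls.flatten, O r) Ls.length := by
  induction Ls with
  | nil => simpa using HasPartition.empty t s
  | cons c Ls ih =>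
    rw [List.flatten_cons] at hL hd ⊢
    rw [List.pairwise_append] at hd
    rw [iUnion_mem_append, List.length_cons, add_comm]
    refine (hp c (by simp) hL.of_append.1).union
      (ih hL.of_append.2 hd.2.1 fun d hd => hp d (by simp [hd])) ?_
    simp only [Set.disjoint_iUnion_left, Set.disjoint_iUnion_right]
    exact fun r hr r' hr' => hd.2.2 r' hr' r hr

theorem exists_forest {α : Type} {t : OTree α} {s : ℝ} (hs : 2 ≤ s) {S : Set (List ℕ)}
    (hS : S.Finite) {L : List (List ℕ)} (hL : IsSiblingInterval L)
    (hopen : ∀ r ∈ L, HasOpenZone t s S r) :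
    ∃ (U C : Set (List ℕ)) (k j M : ℕ), U ∪ C = ⋃ r ∈ L, descendants S r ∧ Disjoint U C ∧
      HasPartition t s C k ∧ HasPartition t s U M ∧ (j ≤ 1 → IsRootedZone t L U) ∧
      (j = 0 → holes t U = ∅) ∧ j ≤ U.ncard ∧
      (k : ℝ) * s + 3 * s * j ≤
        6 * (C.ncard + j) + 3 * s * (holes t S ∩ ⋃ r ∈ L, descendants S r).ncard ∧
      (M : ℝ) * s ≤ s + 2 * (U.ncard - j) + s * j := by
  choose! O C k h hO hOs hOC hdOC hC hh hh0 hk using hopen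
  have hOsub : ∀ r ∈ L, O r ⊆ descendants S r := fun r hr => hOC r hr ▸ Set.subset_union_left
  have hCsub : ∀ r ∈ L, C r ⊆ descendants S r := fun r hr => hOC r hr ▸ Set.subset_union_right
  have hfin : ∀ r, (descendants S r).Finite := fun r => hS.subset fun q hq => hq.1
  have hdis := hL.pairwise_disjoint_descendants S
  have hdO : L.Pairwise fun r r' => Disjoint (O r) (O r') :=
    hdis.imp_of_mem fun hr hr' hd => hd.mono (hOsub _ hr) (hOsub _ hr')
  have hdC : L.Pairwise fun r r' => Disjoint (C r) (C r') :=
    hdis.imp_of_mem fun hr hr' hd => hd.mono (hCsub _ hr) (hCsub _ hr')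
  have hdH : L.Pairwise fun r r' =>
      Disjoint (holes t S ∩ descendants S r) (holes t S ∩ descendants S r') :=
    hdis.imp fun hd => hd.mono Set.inter_subset_right Set.inter_subset_right
  have hOfin : ∀ r ∈ L, (O r).Finite := fun r hr => (hfin r).subset (hOsub r hr)
  have hzone : ∀ c : List (List ℕ), (∀ r ∈ c, r ∈ L) → IsSiblingInterval c →
      (c.map h).sum ≤ 1 → IsRootedZone t c (⋃ r ∈ c, O r) := by
    intro c hcL hci hcs
    refine IsRootedZone.iUnion hci (fun r hr => hO r (hcL r hr)) ?_
    intro x hx y hy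
    simp only [Set.mem_iUnion, exists_prop] at hx hy
    obtain ⟨r, hr, hx⟩ := hx
    obtain ⟨r', hr', hy⟩ := hy
    by_cases hne : r = r'
    · subst hne
      exact (hO r (hcL r hr)).holes_subsingleton hx hy
    · have h1 : h r ≠ 0 := fun h0 => by simp [hh0 r (hcL r hr) h0] at hx
      have h2 : h r' ≠ 0 := fun h0 => by simp [hh0 r' (hcL r' hr') h0] at hy
      have := add_le_sum_map_of_mem h hr hr' hne
      omega
  have hOpos : ∀ r ∈ L, h r ≤ (O r).ncard := fun r hr =>
    (hh r hr).trans ((Set.ncard_pos (hOfin r hr)).2 ⟨r, (hO r hr).top_mem r (by simp)⟩)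
  have hUcard := ncard_iUnion_mem hOfin hdO
  have hCcard := ncard_iUnion_mem (fun r hr => (hfin r).subset (hCsub r hr)) hdC
  have hHcard := ncard_iUnion_mem
    (fun r _ => (hfin r).subset (Set.inter_subset_right (s := holes t S))) hdH
  obtain ⟨Ls, hfl, hLs, hlen⟩ := exists_chunks hs (fun r => (O r).ncard) h L
    fun r hr => ⟨hOs r hr, hh r hr, hOpos r hr⟩
  refine ⟨⋃ r ∈ L, O r, ⋃ r ∈ L, C r, (L.map k).sum, (L.map h).sum, Ls.length, ?_, ?_,
    HasPartition.iUnion hC hdC, ?_, hzone L (fun _ hr => hr) hL, ?_, ?_, ?_, ?_⟩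
  · simp only [← Set.iUnion_union_distrib]
    exact Set.iUnion₂_congr hOC
  · simp only [Set.disjoint_iUnion_left, Set.disjoint_iUnion_right]
    intro r hr r' hr'
    by_cases hne : r = r'
    · subst hne
      exact hdOC r hr
    · rw [Set.disjoint_left]
      intro q hq hq'
      exact hne (hL.eq_of_prefix hr hr' (hCsub r hr hq').2 (hOsub r' hr' hq).2)
  · rw [← hfl]
    refine hasPartition_of_chunks Ls (hfl ▸ hL) (hfl ▸ hdO) fun c hc hci => ?_
    have hcL : ∀ r ∈ c, r ∈ L := fun r hr => hfl ▸ List.mem_flatten_of_mem hc hr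
    refine (hzone c hcL hci (hLs c hc).2).hasPartition ?_
    have hsub : c.Sublist L := hfl ▸ List.sublist_flatten_of_mem hc
    rw [ncard_iUnion_mem (fun r hr => hOfin r (hcL r hr)) (hdO.sublist hsub)]
    exact (hLs c hc).1
  · intro h0
    refine Set.subset_empty_iff.1 ((holes_iUnion_subset t L O).trans ?_)
    intro q hq
    simp only [Set.mem_iUnion, exists_prop] at hq
    obtain ⟨r, hr, hq⟩ := hq
    have := le_sum_map_of_mem h hr
    rwa [hh0 r hr (by omega)] at hq
  · rw [hUcard]
    exact List.sum_le_sum hOpos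
  · rw [hCcard, Set.inter_iUnion₂, hHcard]
    exact weighted_sum_le L k h _ _ hk
  · rw [hUcard]
    exact hlen

theorem IsRootedZone.mem_of_prefix {α : Type} {t : OTree α} {L : List (List ℕ)}
    {S : Set (List ℕ)} (hS : IsRootedZone t L S) {p x q : List ℕ} (hp : p ∈ S) (hq : q ∈ S)
    (hpx : p <+: x) (hxq : x <+: q) : x ∈ S := by
  obtain ⟨r, hr, hrp, -⟩ := hS.conn p hp
  obtain ⟨r', hr', hrq, hc⟩ := hS.conn q hq
  obtain rfl := hS.interval.eq_of_prefix hr hr' (hrp.trans (hpx.trans hxq)) hrq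
  exact hc x (hrp.trans hpx) hxq

theorem exists_child_prefix {p q : List ℕ} (h : p <+: q) (hne : q ≠ p) :
    ∃ i, p ++ [i] <+: q := by
  obtain ⟨l, rfl⟩ := h
  cases l with
  | nil => simp at hne
  | cons i l => exact ⟨i, l, by simp⟩

theorem IsRootedZone.descendants_eq_singleton {α : Type} {t : OTree α} {L : List (List ℕ)}
    {S : Set (List ℕ)} (hS : IsRootedZone t L S) {p : List ℕ} (hp : p ∈ S)
    (hn : ∀ i < numChildren t p, p ++ [i] ∉ S) : descendants S p = {p} := by
  ext q
  refine ⟨fun ⟨hq, hpq⟩ => ?_, ?_⟩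
  swap
  · rintro rfl
    exact ⟨hp, List.prefix_rfl⟩
  by_contra hne
  obtain ⟨i, hi⟩ := exists_child_prefix hpq hne
  have hm := hS.mem_of_prefix hp hq (List.prefix_append p [i]) hi
  exact hn i ((isNode_append_singleton t p i).1 (hS.isNode _ hm)) hm

theorem IsRootedZone.descendants_eq_insert {α : Type} {t : OTree α} {L : List (List ℕ)}
    {S : Set (List ℕ)} (hS : IsRootedZone t L S) {p : List ℕ} (hp : p ∈ S) :
    descendants S p = insert p (⋃ r ∈ children t p, descendants S r) := by
  ext q
  simp only [Set.mem_insert_iff, Set.mem_iUnion, exists_prop]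
  constructor
  · rintro ⟨hq, hpq⟩
    by_cases hne : q = p
    · exact Or.inl hne
    obtain ⟨i, hi⟩ := exists_child_prefix hpq hne
    have hm := hS.mem_of_prefix hp hq (List.prefix_append p [i]) hi
    exact Or.inr ⟨p ++ [i], mem_children.2
      ⟨i, (isNode_append_singleton t p i).1 (hS.isNode _ hm), rfl⟩, hq, hi⟩
  · rintro (rfl | ⟨r, hr, hq, hrq⟩)
    · exact ⟨hp, List.prefix_rfl⟩
    · obtain ⟨i, -, rfl⟩ := mem_children.1 hr
      exact ⟨hq, (List.prefix_append p [i]).trans hrq⟩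

theorem notMem_iUnion_children {α : Type} (t : OTree α) (S : Set (List ℕ)) (p : List ℕ) :
    p ∉ ⋃ r ∈ children t p, descendants S r := by
  simp only [Set.mem_iUnion, exists_prop, not_exists, not_and]
  rintro r hr ⟨-, hrp⟩
  obtain ⟨i, -, rfl⟩ := mem_children.1 hr
  simpa using hrp.length_le

theorem IsRootedZone.hasOpenZone {α : Type} {t : OTree α} {s : ℝ} (hs : 2 ≤ s)
    {L : List (List ℕ)} {S : Set (List ℕ)} (hS : IsRootedZone t L S) (hfin : S.Finite) :
    ∀ p ∈ S, HasOpenZone t s S p := by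
  intro p
  induction hN : (descendants S p).ncard using Nat.strong_induction_on generalizing p with
  | _ N ih =>
  intro hp
  have hdfin : ∀ r, (descendants S r).Finite := fun r => hfin.subset fun q hq => hq.1
  have hpz := isRootedZone_singleton (hS.isNode p hp)
  have hps : (({p} : Set (List ℕ)).ncard : ℝ) ≤ s := by
    rw [Set.ncard_singleton]
    push_cast
    linarith
  by_cases hnone : ∀ i < numChildren t p, p ++ [i] ∉ S
  · have hd := hS.descendants_eq_singleton hp hnone
    rcases Nat.eq_zero_or_pos (numChildren t p) with h0 | h0
    · refine ⟨{p}, ∅, 0, 0, hpz, hps, by simp [hd], by simp, HasPartition.empty t s,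
        by simp, fun _ => ?_, ?_⟩
      · ext q
        simp only [holes, Set.mem_ofPred_eq, Set.mem_singleton_iff, Set.mem_empty_iff_false,
          iff_false, not_and]
        rintro rfl h
        omega
      · simp only [CharP.cast_eq_zero, Set.ncard_empty]
        have : (0 : ℝ) ≤ (holes t S ∩ descendants S p).ncard := Nat.cast_nonneg _
        nlinarith
    · refine ⟨{p}, ∅, 0, 1, hpz, hps, by simp [hd], by simp, HasPartition.empty t s,
        le_rfl, by simp, ?_⟩
      have : holes t S ∩ descendants S p = {p} := by
        rw [hd, Set.inter_eq_right]
        rintro q rfl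
        exact ⟨hp, h0, hnone⟩
      rw [this]
      simp
  · have hall := (hS.all_or_none p hp).resolve_right hnone
    have hD := hS.descendants_eq_insert hp
    have hpD := notMem_iUnion_children t S p
    set D := ⋃ r ∈ children t p, descendants S r with hDdef
    have hDfin : D.Finite := (hdfin p).subset (hD ▸ Set.subset_insert p D)
    obtain ⟨U, C, k, j, M, hUC, hdis, hCk, hUM, hz, hz0, hjU, hk, hM⟩ :=
      exists_forest (t := t) hs hfin (isSiblingInterval_children t p) (by
        intro r hr
        obtain ⟨i, hi, rfl⟩ := mem_children.1 hr
        refine ih _ ?_ (p ++ [i]) rfl (hall i hi)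
        rw [← hN, hD, Set.ncard_insert_of_notMem hpD hDfin, Nat.lt_succ_iff]
        exact Set.ncard_le_ncard
          (Set.subset_biUnion_of_mem (u := fun r => descendants S r) hr) hDfin)
    rw [← hDdef] at hUC hk
    have hUD : U ⊆ D := hUC ▸ Set.subset_union_left
    have hUfin := hDfin.subset hUD
    have hCfin := hDfin.subset (hUC ▸ Set.subset_union_right : C ⊆ D)
    have hmono : ((holes t S ∩ D).ncard : ℝ) ≤ (holes t S ∩ descendants S p).ncard := by
      refine Nat.cast_le.2 (Set.ncard_le_ncard ?_ ((hdfin p).subset Set.inter_subset_right))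
      exact Set.inter_subset_inter_right _ (hD ▸ Set.subset_insert p D)
    have hmono' := mul_le_mul_of_nonneg_left hmono (by linarith : 0 ≤ 3 * s)
    by_cases hm : j ≤ 1 ∧ ((U.ncard + 1 : ℕ) : ℝ) ≤ s
    · refine ⟨insert p U, C, k, j, (hz hm.1).insert_top (hS.isNode p hp), ?_, ?_, ?_, hCk, hm.1,
        fun h0 => ?_, by linarith⟩
      · rw [Set.ncard_insert_of_notMem (fun h => hpD (hUD h)) hUfin]
        exact hm.2
      · rw [Set.insert_union, hUC, hD]
      · rw [Set.disjoint_insert_left]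
        exact ⟨fun h => hpD (hUC ▸ Or.inr h), hdis⟩
      · exact Set.subset_empty_iff.1 (hz0 h0 ▸ holes_insert_subset (hz hm.1))
    · refine ⟨{p}, U ∪ C, M + k, 1, hpz, hps, ?_, ?_, hUM.union hCk hdis, le_rfl, by simp, ?_⟩
      · rw [hUC, hD, Set.singleton_union]
      · rw [hUC]
        simpa using hpD
      · rw [Set.ncard_union_eq hdis hUfin hCfin]
        have hjU' : (j : ℝ) ≤ U.ncard := by exact_mod_cast hjU
        have hj0 : (0 : ℝ) ≤ j := Nat.cast_nonneg _
        push_cast at hm ⊢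
        by_cases hj : j ≤ 1
        · have hW : s < U.ncard + 1 := by
            by_contra hcon
            exact hm ⟨hj, by linarith⟩
          have hj' : (j : ℝ) = 0 ∨ (j : ℝ) = 1 := by
            have : j = 0 ∨ j = 1 := by omega
            exact_mod_cast this
          rcases hj' with hj' | hj' <;> rw [hj'] at hk hM <;> linarith
        · have hj2 : (2 : ℝ) ≤ j := by exact_mod_cast (by omega : 2 ≤ j)
          have := mul_nonneg (by linarith : 0 ≤ s) (by linarith : (0 : ℝ) ≤ j - 2)
          linarith

theorem IsRootedZone.eq_iUnion_descendants {α : Type} {t : OTree α} {L : List (List ℕ)}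
    {S : Set (List ℕ)} (hS : IsRootedZone t L S) : ⋃ r ∈ L, descendants S r = S := by
  ext q
  simp only [Set.mem_iUnion, exists_prop]
  constructor
  · rintro ⟨r, -, hq, -⟩
    exact hq
  · intro hq
    obtain ⟨r, hr, hrq, -⟩ := hS.conn q hq
    exact ⟨r, hr, hq, hrq⟩

/-- A zone with at least `s ≥ 2` nodes splits into at most `10 |S| / s` zones of size `≤ s`. -/
theorem IsRootedZone.exists_hasPartition {α : Type} {t : OTree α} {s : ℝ} (hs : 2 ≤ s)
    {L : List (List ℕ)} {S : Set (List ℕ)} (hS : IsRootedZone t L S) (hfin : S.Finite)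
    (hsS : s ≤ S.ncard) : ∃ K, HasPartition t s S K ∧ (K : ℝ) * s ≤ 10 * S.ncard := by
  obtain ⟨U, C, k, j, M, hUC, hdis, hCk, hUM, -, -, hjU, hk, hM⟩ :=
    exists_forest (t := t) hs hfin hS.interval
      fun r hr => hS.hasOpenZone hs hfin r (hS.top_mem r hr)
  rw [hS.eq_iUnion_descendants] at hUC hk
  refine ⟨M + k, hUC ▸ hUM.union hCk hdis, ?_⟩
  have hcard : (S.ncard : ℝ) = U.ncard + C.ncard := by
    rw [← hUC, Set.ncard_union_eq hdis (hfin.subset (hUC ▸ Set.subset_union_left))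
      (hfin.subset (hUC ▸ Set.subset_union_right))]
    push_cast
    rfl
  have hH : ((holes t S ∩ S).ncard : ℝ) ≤ 1 := by
    have hsub := hS.holes_subsingleton.anti (Set.inter_subset_left (t := S))
    have : Finite ↑(holes t S ∩ S) := hfin.subset Set.inter_subset_right
    exact_mod_cast Set.ncard_le_one_iff_subsingleton.2 hsub
  have hH' := mul_le_mul_of_nonneg_left hH (by linarith : 0 ≤ 3 * s)
  have hjU' : (j : ℝ) ≤ U.ncard := by exact_mod_cast hjU
  have hj0 : (0 : ℝ) ≤ (s - 2) * j := mul_nonneg (by linarith) (Nat.cast_nonneg _)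
  push_cast
  linarith

/-- If a zone has at most `m * s` nodes, it splits into at most `10 * m` zones of size `≤ s`. -/
theorem IsRootedZone.exists_hasPartition_of_le {α : Type} {t : OTree α} {s m : ℝ} (hs : 1 ≤ s)
    (hm : 1 ≤ m) {L : List (List ℕ)} {S : Set (List ℕ)} (hS : IsRootedZone t L S)
    (hfin : S.Finite) (hsS : (S.ncard : ℝ) ≤ m * s) :
    ∃ K, HasPartition t s S K ∧ (K : ℝ) ≤ 10 * m := by
  rcases le_total (S.ncard : ℝ) s with h | h
  · exact ⟨1, hS.hasPartition h, by push_cast; linarith⟩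
  rcases le_total 2 s with h2 | h2
  · obtain ⟨K, hK, hKs⟩ := hS.exists_hasPartition h2 hfin h
    refine ⟨K, hK, le_of_mul_le_mul_right ?_ (by linarith : 0 < s)⟩
    linarith
  · exact ⟨_, hasPartition_ncard hs hfin hS.isNode, by nlinarith⟩

theorem IsRootedZone.hasHierarchy {α : Type} {t : OTree α} {θ : ℝ} (hθ : 0 < θ) {n : ℕ}
    (hn : 1 ≤ n) (ℓ : ℕ) {L : List (List ℕ)} {S : Set (List ℕ)} (hS : IsRootedZone t L S)
    (hcard : (S.ncard : ℝ) ≤ (n : ℝ) ^ (((ℓ : ℝ) + 1) * θ)) :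
    HasHierarchy t 10 θ n (ℓ + 1) S := by
  induction ℓ generalizing L S with
  | zero => exact ⟨hS.isZone, by simpa using hcard⟩
  | succ ℓ ih =>
    have hn' : (1 : ℝ) ≤ n := by exact_mod_cast hn
    have hfin : S.Finite := (nodes_finite t).subset hS.isNode
    have hcard' : (S.ncard : ℝ) ≤ (n : ℝ) ^ (((ℓ : ℝ) + 2) * θ) := by
      convert hcard using 3
      push_cast
      ring
    obtain ⟨K, ⟨Z, hZ, hd, hU, hg⟩, hK⟩ := hS.exists_hasPartition_of_le
      (s := (n : ℝ) ^ (((ℓ : ℝ) + 1) * θ)) (m := (n : ℝ) ^ θ)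
      (Real.one_le_rpow hn' (by positivity)) (Real.one_le_rpow hn' hθ.le) hfin (by
        rw [← Real.rpow_add (by linarith)]
        convert hcard' using 2
        ring)
    refine ⟨hS.isZone, hcard', Z, ?_, hd, hU, fun A hA => ?_⟩
    · have : (Z.card : ℝ) ≤ K := by exact_mod_cast hZ
      push_cast
      linarith
    · obtain ⟨⟨M, hM⟩, hs⟩ := hg A hA
      exact ih hM hs

end OTree

open OTree in
/-- for each `θ > 0` with `h = 1/θ` an integer, every finite ordered
tree has a `(10, θ)`-bounded partition hierarchy of height `h`, with the whole
tree (of `n` nodes) as top zone. -/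
theorem partition_hierarchy_exists {α : Type} (θ : ℝ) (h : ℕ)
    (hθ : 0 < θ) (hhθ : (h : ℝ) * θ = 1) (t : OTree α) :
    HasHierarchy t 10 θ (nodes t).ncard h (nodes t) := by
  have hn : 1 ≤ (nodes t).ncard :=
    (Set.ncard_pos (nodes_finite t)).2 ⟨[], (isRootedZone_nodes t).top_mem [] (by simp)⟩
  cases h with
  | zero => simp at hhθ
  | succ ℓ =>
    refine (isRootedZone_nodes t).hasHierarchy hθ hn ℓ ?_
    push_cast at hhθ
    rw [hhθ, Real.rpow_one]
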